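/- Let H ∈ (0,1) and let W^H be the law of fractional Brownian motion with Hurst parameter H. Then for W^H-almost every ω ∈ Ω, the Orey exponent of ω exists and equals H, and ω ∈ C_H^- (i.e. ω is β-Hölder for every β < H). -/

import Mathlib

open scoped ENNReal NNReal Topology
open Filter MeasureTheory Metric Set

noncomputable section

namespace Multifractal


/-- The `δ`-level Hausdorff pre-measure `H^h_δ` associated to a gauge `h`. -/
def hMeasAux {X : Type*} [MetricSpace X] (h : ℝ → ℝ) (δ : ℝ≥0∞) (E : Set X) : ℝ≥0∞ :=
  ⨅ (c : ℕ → X) (r : ℕ → ℝ) (_ : ∀ n, 0 < r n ∧ ENNReal.ofReal (r n) ≤ δ)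
    (_ : E ⊆ ⋃ n, Metric.ball (c n) (r n)), ∑' n, ENNReal.ofReal (h (r n))

/-- The `h`-Hausdorff measure. -/
def hMeas {X : Type*} [MetricSpace X] (h : ℝ → ℝ) (E : Set X) : ℝ≥0∞ :=
  ⨆ (δ : ℝ≥0∞) (_ : 0 < δ), hMeasAux h δ E

/-- `Ω`: continuous paths on `[0,1]` vanishing at `0`, with the uniform metric. -/
abbrev PathSpace : Type := {f : C(unitInterval, ℝ) // f 0 = 0}

instance : MeasurableSpace PathSpace := borel PathSpace
instance : BorelSpace PathSpace := ⟨rfl⟩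

/-- `μ` is a centered Gaussian process measure on path space with covariance `K`:
a probability measure under which every finite linear combination of coordinates
is a centered real Gaussian with the variance given by `K`. -/
def IsGaussianProcess (μ : Measure PathSpace) (K : unitInterval → unitInterval → ℝ) : Prop :=
  IsProbabilityMeasure μ ∧
  ∀ (n : ℕ) (t : Fin n → unitInterval) (c : Fin n → ℝ),
    Measure.map (fun ω : PathSpace => ∑ i, c i * ω.1 (t i)) μ =
      ProbabilityTheory.gaussianReal 0
        (Real.toNNReal (∑ i, ∑ j, c i * c j * K (t i) (t j)))

/-- `W` is the Wiener measure: the coordinate process is centered Gaussian with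
covariance `min s t`. -/
def IsWienerMeasure (W : Measure PathSpace) : Prop :=
  IsGaussianProcess W (fun s t => min (s : ℝ) (t : ℝ))

/-- `μ` is the law of fractional Brownian motion with Hurst parameter `H`. -/
def IsFBM (H : ℝ) (μ : Measure PathSpace) : Prop :=
  IsGaussianProcess μ (fun s t =>
    ((s : ℝ) ^ (2*H) + (t : ℝ) ^ (2*H) - |(t : ℝ) - (s : ℝ)| ^ (2*H)) / 2)

/-- Clamping of a real number into the unit interval. -/
def clampI (t : ℝ) : unitInterval :=
  ⟨min (max t 0) 1, Set.mem_Icc.mpr ⟨le_min (le_max_right _ _) zero_le_one, min_le_right _ _⟩⟩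

/-- The grid point `j/n` of the unit interval. -/
def gridPt (n j : ℕ) : unitInterval := clampI ((j : ℝ) / n)

/-- The discrete quadratic variation `Q_n(ω)`. -/
def Qvar (ω : PathSpace) (n : ℕ) : ℝ :=
  Real.sqrt ((1 / (n : ℝ)) *
    ∑ i ∈ Finset.range n, (ω.1 (gridPt n (i+1)) - ω.1 (gridPt n i)) ^ 2)

/-- Lower Orey exponent `q^-(ω)`. -/
def oreyLower (ω : PathSpace) : EReal :=
  liminf (fun n : ℕ => ((-Real.log (Qvar ω n) / Real.log n : ℝ) : EReal)) atTop

/-- Upper Orey exponent `q^+(ω)`. -/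
def oreyUpper (ω : PathSpace) : EReal :=
  limsup (fun n : ℕ => ((-Real.log (Qvar ω n) / Real.log n : ℝ) : EReal)) atTop

/-- The set `C_a` of `a`-Hölder paths. -/
def holderSet (a : ℝ) : Set PathSpace :=
  {ω | ∃ C : ℝ, ∀ x y : unitInterval, |ω.1 x - ω.1 y| ≤ C * |(x : ℝ) - (y : ℝ)| ^ a}

/-- The set `C_a^- = ⋂_{0<b<a} C_b` of nearly `a`-Hölder paths. -/
def holderMinus (a : ℝ) : Set PathSpace := ⋂ b ∈ Set.Ioo (0:ℝ) a, holderSet b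

/-- The set `C_q^crit` of critical `q`-Hölder paths: nearly `q`-Hölder paths whose
Orey exponent exists and equals `q`. -/
def holderCrit (q : ℝ) : Set PathSpace :=
  {ω | ω ∈ holderMinus q ∧ oreyLower ω = (q : EReal) ∧ oreyUpper ω = (q : EReal)}

/-- The set `Ω^crit` of critical Hölder paths. -/
def pathCrit : Set PathSpace := ⋃ q ∈ Set.Ioo (0:ℝ) 1, holderCrit q

/-- The lower local order of a measure `μ` on path space at `ω`. -/
def lowerLocOrd (μ : Measure PathSpace) (ω : PathSpace) : EReal :=
  liminf (fun ε : ℝ =>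
    ((Real.log (-Real.log ((μ (Metric.ball ω ε)).toReal)) / (-Real.log ε) : ℝ) : EReal))
    (𝓝[>] (0:ℝ))

/-- The upper local order of a measure `μ` on path space at `ω`. -/
def upperLocOrd (μ : Measure PathSpace) (ω : PathSpace) : EReal :=
  limsup (fun ε : ℝ =>
    ((Real.log (-Real.log ((μ (Metric.ball ω ε)).toReal)) / (-Real.log ε) : ℝ) : EReal))
    (𝓝[>] (0:ℝ))

/-- The Hausdorff order of a set of paths: `sup {α > 0 : H^{h_α}(A) = ∞}` where
`h_α(ε) = exp(-ε^{-α})`. -/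
def ordH (A : Set PathSpace) : ℝ≥0∞ :=
  ⨆ (α : ℝ) (_ : 0 < α ∧ hMeas (fun ε : ℝ => Real.exp (-(ε ^ (-α)))) A = ∞),
    ENNReal.ofReal α

/-- The level set `E(ξ)` of paths at which the local order of `μ` exists and
equals `ξ`. -/
def levelOrd (μ : Measure PathSpace) (ξ : ℝ) : Set PathSpace :=
  {ω | lowerLocOrd μ ω = (ξ : EReal) ∧ upperLocOrd μ ω = (ξ : EReal)}

/-- The cylinder `C_n(ω̄, ε)` around `ω̄` of depth `n` and radius `ε`. -/
def cylinder (ωb : PathSpace) (n : ℕ) (ε : ℝ) : Set PathSpace :=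
  {ω | ∀ j ∈ Finset.Icc 1 n, |ω.1 (gridPt n j) - ωb.1 (gridPt n j)| ≤ ε}

/-- The affine interpolation `L̄_j` of `ω̄` on `[(j-1)/n, j/n]`, evaluated at `t`. -/
def affInterp (ωb : PathSpace) (n j : ℕ) (t : ℝ) : ℝ :=
  ωb.1 (gridPt n (j-1)) +
    (t - ((j-1 : ℕ) : ℝ) / n) * n * (ωb.1 (gridPt n j) - ωb.1 (gridPt n (j-1)))

/-- The maximal deviation `Δ_n(ω̄)` of `ω̄` from its chords on the `1/n`-grid. -/
def chordDev (ωb : PathSpace) (n : ℕ) : ℝ :=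
  sSup {d : ℝ | ∃ j ∈ Finset.Icc 1 n, ∃ t ∈ Set.Icc (((j-1 : ℕ) : ℝ) / n) ((j : ℝ) / n),
    d = |ωb.1 (clampI t) - affInterp ωb n j t|}


open ProbabilityTheory

/-- A Gaussian average of a Gaussian bump is bounded by the flat average of the bump. -/
lemma integral_exp_neg_mul_sq_gaussianReal_le {c : ℝ} (hc : 0 < c) :
    ∫ x, Real.exp (-c * x ^ 2) ∂(gaussianReal 0 1) ≤ (√(2 * c))⁻¹ := by
  rw [integral_gaussianReal_eq_integral_smul (by norm_num)]
  have hle : ∀ x : ℝ, gaussianPDFReal 0 1 x • Real.exp (-c * x ^ 2) ≤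
      (√(2 * Real.pi))⁻¹ * Real.exp (-c * x ^ 2) := by
    intro x
    rw [smul_eq_mul]
    gcongr
    simp only [gaussianPDFReal, NNReal.coe_one, mul_one]
    refine mul_le_of_le_one_right (by positivity) (Real.exp_le_one_iff.2 ?_)
    have := sq_nonneg (x - 0)
    linarith
  have hintegrable : Integrable fun x : ℝ => (√(2 * Real.pi))⁻¹ * Real.exp (-c * x ^ 2) :=
    (integrable_exp_neg_mul_sq hc).const_mul _
  calc ∫ x, gaussianPDFReal 0 1 x • Real.exp (-c * x ^ 2)
      ≤ ∫ x : ℝ, (√(2 * Real.pi))⁻¹ * Real.exp (-c * x ^ 2) := by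
        refine integral_mono_of_nonneg (ae_of_all _ fun x => ?_) hintegrable (ae_of_all _ hle)
        exact smul_nonneg (gaussianPDFReal_nonneg _ _ _) (Real.exp_pos _).le
    _ = (√(2 * c))⁻¹ := by
        rw [integral_const_mul, integral_gaussian, ← Real.sqrt_inv, ← Real.sqrt_inv,
          ← Real.sqrt_mul (by positivity)]
        congr 1
        field_simp

/-- Laplace transform of the squared norm of a Gaussian vector, expressed by averaging its
characteristic function against a standard Gaussian vector. -/
lemma integral_exp_neg_mul_sum_sq {Ω' : Type*} [MeasurableSpace Ω'] {μ : Measure Ω'}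
    [IsProbabilityMeasure μ] {m : ℕ} {X : Fin m → Ω' → ℝ} (hX : ∀ j, Measurable (X j))
    {v : (Fin m → ℝ) → ℝ≥0}
    (hlaw : ∀ g : Fin m → ℝ, μ.map (fun ω => ∑ j, g j * X j ω) = gaussianReal 0 (v g))
    {l : ℝ} (hl : 0 ≤ l) :
    ∫ ω, Real.exp (-l * ∑ j, X j ω ^ 2) ∂μ =
      ∫ g, Real.exp (-l * v g) ∂(Measure.pi fun _ : Fin m => gaussianReal 0 1) := by
  set γ : Measure (Fin m → ℝ) := Measure.pi fun _ : Fin m => gaussianReal 0 1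
  set r : ℝ := √(2 * l)
  have hr : r ^ 2 = 2 * l := Real.sq_sqrt (by positivity)
  have hrC : (r : ℂ) ^ 2 = 2 * l := by exact_mod_cast congrArg Complex.ofReal hr
  let F : Ω' → (Fin m → ℝ) → ℂ := fun ω g =>
    Complex.exp ((r : ℂ) * ((∑ j, g j * X j ω : ℝ) : ℂ) * Complex.I)
  have hFint : Integrable (Function.uncurry F) (μ.prod γ) := by
    refine Integrable.of_bound (C := 1) ?_ (ae_of_all _ fun p => ?_)
    · refine Measurable.aestronglyMeasurable ?_
      simp only [F, Function.uncurry_def]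
      fun_prop
    · simp only [F, Function.uncurry_def]
      rw [← Complex.ofReal_mul, Complex.norm_exp_ofReal_mul_I]
  have hin : ∀ ω, ∫ g, F ω g ∂γ = ((Real.exp (-l * ∑ j, X j ω ^ 2) : ℝ) : ℂ) := by
    intro ω
    have hprod : ∀ g, F ω g = ∏ j, Complex.exp (((r * X j ω : ℝ) : ℂ) * (g j : ℂ) * Complex.I) := by
      intro g
      rw [← Complex.exp_sum]
      simp only [F]
      congr 1
      push_cast
      rw [Finset.mul_sum, Finset.sum_mul]
      exact Finset.sum_congr rfl fun j _ => by ring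
    simp_rw [hprod]
    rw [integral_fintype_prod_eq_prod
      (f := fun j (x : ℝ) => Complex.exp (((r * X j ω : ℝ) : ℂ) * (x : ℂ) * Complex.I))]
    simp_rw [← charFun_apply_real, charFun_gaussianReal]
    rw [← Complex.exp_sum]
    push_cast
    congr 1
    rw [Finset.mul_sum]
    refine Finset.sum_congr rfl fun j _ => ?_
    rw [mul_pow, hrC]
    ring
  have hout : ∀ g, ∫ ω, F ω g ∂μ = ((Real.exp (-l * v g) : ℝ) : ℂ) := by
    intro g
    have hmeas : Measurable fun ω => ∑ j, g j * X j ω := by fun_prop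
    have h := charFun_gaussianReal (μ := 0) (v := v g) r
    rw [← hlaw g, charFun_apply_real, integral_map hmeas.aemeasurable (by fun_prop)] at h
    simp only [F]
    rw [h, hrC]
    push_cast
    congr 1
    ring
  have hswap := integral_integral_swap hFint
  simp_rw [hin, hout] at hswap
  rw [integral_complex_ofReal, integral_complex_ofReal] at hswap
  exact_mod_cast hswap

/-- The Laplace transform of the squared norm of a nondegenerate Gaussian vector decays at a
rate given by its dimension. -/
lemma integral_exp_neg_mul_sum_sq_le {Ω' : Type*} [MeasurableSpace Ω'] {μ : Measure Ω'}
    [IsProbabilityMeasure μ] {m : ℕ} {X : Fin m → Ω' → ℝ} (hX : ∀ j, Measurable (X j))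
    {v : (Fin m → ℝ) → ℝ≥0}
    (hlaw : ∀ g : Fin m → ℝ, μ.map (fun ω => ∑ j, g j * X j ω) = gaussianReal 0 (v g))
    {s : ℝ} (hs : 0 < s) (hv : ∀ g, s * ∑ j, g j ^ 2 ≤ v g) {l : ℝ} (hl : 0 < l) :
    ∫ ω, Real.exp (-l * ∑ j, X j ω ^ 2) ∂μ ≤ (√(2 * (l * s)))⁻¹ ^ m := by
  rw [integral_exp_neg_mul_sum_sq hX hlaw hl.le]
  calc ∫ g, Real.exp (-l * v g) ∂(Measure.pi fun _ : Fin m => gaussianReal 0 1)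
      ≤ ∫ g, ∏ j, Real.exp (-(l * s) * g j ^ 2)
          ∂(Measure.pi fun _ : Fin m => gaussianReal 0 1) := by
        refine integral_mono_of_nonneg (ae_of_all _ fun g => (Real.exp_pos _).le) ?_
          (ae_of_all _ fun g => ?_)
        · refine Integrable.of_bound (C := 1) (Measurable.aestronglyMeasurable (by fun_prop))
            (ae_of_all _ fun g => ?_)
          rw [Real.norm_of_nonneg (Finset.prod_nonneg fun j _ => (Real.exp_pos _).le)]
          refine Finset.prod_le_one (fun j _ => (Real.exp_pos _).le) fun j _ => ?_
          rw [Real.exp_le_one_iff]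
          have := mul_nonneg (mul_pos hl hs).le (sq_nonneg (g j))
          linarith
        · show Real.exp (-l * v g) ≤ ∏ j, Real.exp (-(l * s) * g j ^ 2)
          rw [← Real.exp_sum, Real.exp_le_exp, ← Finset.mul_sum]
          have := mul_le_mul_of_nonneg_left (hv g) hl.le
          linarith
    _ = (∫ x, Real.exp (-(l * s) * x ^ 2) ∂(gaussianReal 0 1)) ^ m := by
        rw [integral_fintype_prod_eq_pow (f := fun x : ℝ => Real.exp (-(l * s) * x ^ 2)),
          Fintype.card_fin]
    _ ≤ _ := by
        gcongr
        exact integral_exp_neg_mul_sq_gaussianReal_le (mul_pos hl hs)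

/-- The second difference of `x ↦ x ^ a` is controlled by the second derivative. -/
lemma abs_second_difference_rpow_le {a x : ℝ} (ha0 : 0 < a) (ha2 : a < 2) (hx : 1 < x) :
    |(x + 1) ^ a + (x - 1) ^ a - 2 * x ^ a| ≤ 2 * (x - 1) ^ (a - 2) := by
  have hd : ∀ y, x - 1 < y → ∀ b : ℝ, HasDerivAt (fun z : ℝ => z ^ b) (b * y ^ (b - 1)) y :=
    fun y hy b => Real.hasDerivAt_rpow_const (Or.inl (by linarith))
  obtain ⟨c, hc, hceq⟩ := exists_hasDerivAt_eq_slope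
    (fun y : ℝ => y ^ a - (y - 1) ^ a) (fun y => a * y ^ (a - 1) - a * (y - 1) ^ (a - 1))
    (lt_add_one x)
    ((continuousOn_id.rpow_const fun y hy => Or.inr ha0.le).sub
      ((continuousOn_id.sub continuousOn_const).rpow_const fun y hy => Or.inr ha0.le))
    (fun y hy => (hd y (by linarith [hy.1]) a).sub
      (HasDerivAt.comp_sub_const y 1 (hd (y - 1) (by linarith [hy.1]) a)))
  obtain ⟨e, he, heeq⟩ := exists_hasDerivAt_eq_slope
    (fun y : ℝ => y ^ (a - 1)) (fun y => (a - 1) * y ^ (a - 1 - 1)) (sub_one_lt c)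
    (continuousOn_id.rpow_const fun y hy => Or.inl
      (ne_of_gt (show (0 : ℝ) < y by linarith [hc.1, hy.1])))
    (fun y hy => hd y (by linarith [hy.1, hc.1]) (a - 1))
  have hkey : (x + 1) ^ a + (x - 1) ^ a - 2 * x ^ a = a * (a - 1) * e ^ (a - 2) := by
    have h1 : a * c ^ (a - 1) - a * (c - 1) ^ (a - 1) =
        (x + 1) ^ a + (x - 1) ^ a - 2 * x ^ a := by
      rw [hceq]; simp only [add_sub_cancel_left, div_one, add_sub_cancel_right]; ring
    have h2 : (a - 1) * e ^ (a - 2) = c ^ (a - 1) - (c - 1) ^ (a - 1) := by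
      rw [show a - 2 = a - 1 - 1 by ring, heeq, sub_sub_cancel, div_one]
    rw [← h1, mul_assoc, h2]; ring
  have hxe : x - 1 < e := by linarith [hc.1, he.1]
  have hpow : e ^ (a - 2) ≤ (x - 1) ^ (a - 2) :=
    Real.rpow_le_rpow_of_nonpos (by linarith) hxe.le (by linarith)
  have hcoef : |a * (a - 1)| ≤ 2 := by
    rw [abs_le]; constructor <;> nlinarith
  rw [hkey, abs_mul, abs_of_pos (Real.rpow_pos_of_pos (by linarith : 0 < e) _)]
  exact mul_le_mul hcoef hpow (Real.rpow_nonneg (by linarith) _) (by norm_num)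

/-- Autocovariance of fractional Gaussian noise with unit steps, with exponent `a = 2H`. -/
def noiseCov (a x : ℝ) : ℝ := (|x + 1| ^ a + |x - 1| ^ a - 2 * |x| ^ a) / 2

lemma noiseCov_zero {a : ℝ} (ha : a ≠ 0) : noiseCov a 0 = 1 := by
  simp [noiseCov, Real.zero_rpow ha]

lemma noiseCov_neg (a x : ℝ) : noiseCov a (-x) = noiseCov a x := by
  have h1 : |-x + 1| = |x - 1| := by rw [← abs_neg]; ring_nf
  have h2 : |-x - 1| = |x + 1| := by rw [← abs_neg]; ring_nf
  rw [noiseCov, noiseCov, h1, h2, abs_neg]; ring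

lemma exists_forall_abs_noiseCov_le {a δ : ℝ} (ha0 : 0 < a) (ha2 : a < 2) (hδ : 0 < δ) :
    ∃ K : ℝ, ∀ x, K ≤ |x| → |noiseCov a x| ≤ δ := by
  have hlim : Tendsto (fun x : ℝ => (x - 1) ^ (a - 2)) atTop (𝓝 0) := by
    have h := tendsto_rpow_neg_atTop (y := 2 - a) (by linarith)
    rw [neg_sub] at h
    exact h.comp (tendsto_atTop_add_const_right atTop (-1) tendsto_id)
  obtain ⟨K, hK⟩ := eventually_atTop.1 ((hlim.eventually_le_const hδ).and (eventually_gt_atTop 1))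
  refine ⟨K, fun x hx => ?_⟩
  obtain ⟨hsmall, h1⟩ := hK _ hx
  have habs : noiseCov a x = noiseCov a |x| := by
    rcases abs_choice x with h | h <;> rw [h]
    rw [noiseCov_neg]
  have hb := abs_second_difference_rpow_le ha0 ha2 h1
  rw [habs, noiseCov, abs_div, abs_of_pos (by linarith : 0 < |x| + 1),
    abs_of_pos (by linarith : 0 < |x| - 1), abs_abs, abs_two]
  linarith

/-- A matrix with unit diagonal and small off-diagonal entries is bounded below. -/
lemma half_sum_sq_le_of_offDiag_small {m : ℕ} {A : Fin m → Fin m → ℝ} (hdiag : ∀ i, A i i = 1)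
    (hoff : ∀ i j, i ≠ j → |A i j| ≤ 1 / (2 * m)) (g : Fin m → ℝ) :
    (∑ i, g i ^ 2) / 2 ≤ ∑ i, ∑ j, g i * g j * A i j := by
  rcases Nat.eq_zero_or_pos m with rfl | hm
  · simp
  have hm' : (0 : ℝ) < m := by exact_mod_cast hm
  have hterm : ∀ i j, (if i = j then g i ^ 2 else 0) - 1 / (2 * m) * ((g i ^ 2 + g j ^ 2) / 2) ≤
      g i * g j * A i j := by
    intro i j
    split_ifs with hij
    · subst hij
      rw [hdiag]
      have : 0 ≤ 1 / (2 * (m : ℝ)) * ((g i ^ 2 + g i ^ 2) / 2) := by positivity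
      nlinarith
    · have h1 : |g i * g j * A i j| ≤ (g i ^ 2 + g j ^ 2) / 2 * (1 / (2 * m)) := by
        rw [abs_mul]
        refine mul_le_mul ?_ (hoff i j hij) (abs_nonneg _) (by positivity)
        rw [abs_le]; constructor <;> nlinarith [sq_nonneg (g i + g j), sq_nonneg (g i - g j)]
      have := (abs_le.1 h1).1
      linarith
  refine le_trans (le_of_eq ?_) (Finset.sum_le_sum fun i _ => Finset.sum_le_sum fun j _ => hterm i j)
  simp only [Finset.sum_sub_distrib, ← Finset.mul_sum, ← Finset.sum_div, Finset.sum_add_distrib,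
    Finset.sum_ite_eq, Finset.mem_univ, if_true, Finset.sum_const, Finset.card_univ,
    Fintype.card_fin, nsmul_eq_mul]
  field_simp
  ring

lemma measurable_eval (t : unitInterval) : Measurable fun ω : PathSpace => ω.1 t :=
  ((continuous_eval_const t).comp continuous_subtype_val).measurable

lemma IsGaussianProcess.map_sum {μ : Measure PathSpace} {K : unitInterval → unitInterval → ℝ}
    (h : IsGaussianProcess μ K) {ι : Type*} [Fintype ι] (t : ι → unitInterval) (c : ι → ℝ) :
    μ.map (fun ω : PathSpace => ∑ i, c i * ω.1 (t i)) =
      gaussianReal 0 (Real.toNNReal (∑ i, ∑ j, c i * c j * K (t i) (t j))) := by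
  let e := (Fintype.equivFin ι).symm
  have h' := h.2 (Fintype.card ι) (t ∘ e) (c ∘ e)
  simp only [Function.comp_apply] at h'
  simp_rw [fun i => e.sum_comp fun j => c i * c j * K (t i) (t j)] at h'
  rw [e.sum_comp fun i => ∑ j, c i * c j * K (t i) (t j)] at h'
  simp_rw [fun ω : PathSpace => e.sum_comp fun i => c i * ω.1 (t i)] at h'
  exact h'

/-- Law of a linear combination of increments of fractional Brownian motion. -/
lemma IsFBM.map_sum_increments {H : ℝ} {μ : Measure PathSpace} (h : IsFBM H μ) {ι : Type*}
    [Fintype ι] (s t : ι → unitInterval) (g : ι → ℝ) :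
    μ.map (fun ω : PathSpace => ∑ i, g i * (ω.1 (t i) - ω.1 (s i))) =
      gaussianReal 0 (Real.toNNReal (∑ i, ∑ j, g i * g j *
        ((|(t i : ℝ) - s j| ^ (2 * H) + |(s i : ℝ) - t j| ^ (2 * H)
          - |(t i : ℝ) - t j| ^ (2 * H) - |(s i : ℝ) - s j| ^ (2 * H)) / 2))) := by
  have h' := IsGaussianProcess.map_sum h (Sum.elim t s) (Sum.elim g fun i => -g i)
  simp only [Fintype.sum_sum_type, Sum.elim_inl, Sum.elim_inr, ← Finset.sum_add_distrib] at h'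
  convert h' using 2
  · funext ω
    exact Finset.sum_congr rfl fun i _ => by ring
  · congr 1
    refine Finset.sum_congr rfl fun i _ => Finset.sum_congr rfl fun j _ => ?_
    rw [abs_sub_comm (t i : ℝ) (s j), abs_sub_comm (s i : ℝ) (t j), abs_sub_comm (t i : ℝ) (t j),
      abs_sub_comm (s i : ℝ) (s j)]
    ring

lemma IsFBM.map_increment {H : ℝ} {μ : Measure PathSpace} (hH : 0 < H) (h : IsFBM H μ)
    (s t : unitInterval) :
    μ.map (fun ω : PathSpace => ω.1 t - ω.1 s) =
      gaussianReal 0 (Real.toNNReal (|(t : ℝ) - s| ^ (2 * H))) := by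
  have h' := h.map_sum_increments (fun _ : Unit => s) (fun _ => t) (fun _ => 1)
  simp only [Finset.univ_unique, Finset.sum_singleton, one_mul, sub_self, abs_zero,
    Real.zero_rpow (by positivity : 2 * H ≠ 0), sub_zero, abs_sub_comm (s : ℝ) t,
    add_self_div_two] at h'
  exact h'

lemma coe_gridPt {n j : ℕ} (hj : j ≤ n) : (gridPt n j : ℝ) = j / n := by
  have h1 : (j : ℝ) / n ≤ 1 := div_le_one_of_le₀ (by exact_mod_cast hj) (by positivity)
  have h0 : (0 : ℝ) ≤ (j : ℝ) / n := by positivity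
  simp [gridPt, clampI, h0, h1]

/-- The increments of fractional Brownian motion over the `1/n`-grid form, after rescaling,
fractional Gaussian noise. -/
lemma IsFBM.map_sum_gridIncrements {H : ℝ} {μ : Measure PathSpace} (h : IsFBM H μ) {m n : ℕ}
    {k : Fin m → ℕ} (hk : ∀ i, k i < n) (g : Fin m → ℝ) :
    μ.map (fun ω : PathSpace => ∑ i, g i * (ω.1 (gridPt n (k i + 1)) - ω.1 (gridPt n (k i)))) =
      gaussianReal 0 (Real.toNNReal ((n : ℝ) ^ (-(2 * H)) *
        ∑ i, ∑ j, g i * g j * noiseCov (2 * H) ((k i : ℝ) - k j))) := by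
  rw [h.map_sum_increments (fun i => gridPt n (k i)) (fun i => gridPt n (k i + 1)) g]
  congr 2
  rw [Finset.mul_sum]
  refine Finset.sum_congr rfl fun i _ => ?_
  rw [Finset.mul_sum]
  refine Finset.sum_congr rfl fun j _ => ?_
  have hn : (0 : ℝ) < n := by exact_mod_cast (Nat.zero_le _).trans_lt (hk i)
  have hscale : ∀ x : ℝ, |x / n| ^ (2 * H) = (n : ℝ) ^ (-(2 * H)) * |x| ^ (2 * H) := by
    intro x
    rw [abs_div, abs_of_pos hn, Real.div_rpow (abs_nonneg _) hn.le, Real.rpow_neg hn.le,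
      div_eq_inv_mul]
  rw [coe_gridPt (hk i), coe_gridPt (hk j), coe_gridPt (hk i).le, coe_gridPt (hk j).le]
  simp only [← sub_div, hscale]
  push_cast
  rw [show (k i : ℝ) + 1 - k j = k i - k j + 1 by ring,
    show (k i : ℝ) - (k j + 1) = k i - k j - 1 by ring,
    show (k i : ℝ) + 1 - (k j + 1) = k i - k j by ring, noiseCov]
  ring

lemma sum_range_mul_eq_sum_sum (F : ℕ → ℝ) (L m : ℕ) :
    ∑ i ∈ Finset.range (L * m), F i = ∑ r ∈ Finset.range L, ∑ j : Fin m, F (r + j * L) := by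
  simp_rw [fun r => Fin.sum_univ_eq_sum_range (fun j => F (r + j * L)) m]
  rw [Finset.sum_comm]
  induction m with
  | zero => simp
  | succ m ih =>
    rw [Nat.mul_succ, Finset.sum_range_add, ih, Finset.sum_range_succ]
    congr 1
    exact Finset.sum_congr rfl fun r _ => by rw [add_comm, mul_comm]

/-- Jensen's inequality for the exponential of a sum of `L` terms. -/
lemma exp_sum_le_average {L : ℕ} (hL : 0 < L) (S : ℕ → ℝ) :
    Real.exp (∑ r ∈ Finset.range L, S r) ≤
      ∑ r ∈ Finset.range L, (L : ℝ)⁻¹ * Real.exp (L * S r) := by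
  have hL' : (L : ℝ) ≠ 0 := by exact_mod_cast hL.ne'
  have h := convexOn_exp.map_sum_le (t := Finset.range L) (w := fun _ => (L : ℝ)⁻¹)
    (p := fun r => L * S r) (fun _ _ => by positivity) (by simp [hL']) (fun _ _ => mem_univ _)
  simpa [smul_eq_mul, inv_mul_cancel_left₀ hL'] using h

/-- The sum of squared increments of `ω` over the `1/n`-grid. -/
def sumSqIncrements (ω : PathSpace) (n : ℕ) : ℝ :=
  ∑ i ∈ Finset.range n, (ω.1 (gridPt n (i + 1)) - ω.1 (gridPt n i)) ^ 2

lemma measurable_sumSqIncrements (n : ℕ) : Measurable fun ω => sumSqIncrements ω n :=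
  Finset.measurable_sum _ fun _ _ =>
    ((measurable_eval _).sub (measurable_eval _)).pow_const 2

lemma sumSqIncrements_nonneg (ω : PathSpace) (n : ℕ) : 0 ≤ sumSqIncrements ω n :=
  Finset.sum_nonneg fun _ _ => sq_nonneg _

lemma integrable_exp_neg_mul {Ω' : Type*} [MeasurableSpace Ω'] {μ : Measure Ω'}
    [IsFiniteMeasure μ] {Y : Ω' → ℝ} (hY : Measurable Y) (hY0 : ∀ ω, 0 ≤ Y ω) {l : ℝ}
    (hl : 0 ≤ l) : Integrable (fun ω => Real.exp (-l * Y ω)) μ := by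
  refine Integrable.of_bound (C := 1) (Measurable.aestronglyMeasurable (by fun_prop))
    (ae_of_all _ fun ω => ?_)
  rw [Real.norm_of_nonneg (Real.exp_pos _).le, Real.exp_le_one_iff]
  have := mul_nonneg hl (hY0 ω)
  linarith

/-- The Laplace transform of the quadratic variation, estimated by splitting the grid into
families of `m` increments with spacing `L`, which are nearly independent. -/
lemma IsFBM.integral_exp_neg_sumSqIncrements_le {H : ℝ} (hH : H ∈ Ioo (0 : ℝ) 1)
    {μ : Measure PathSpace} (h : IsFBM H μ) {m n L : ℕ} (hL : 0 < L) (hLm : L * m ≤ n)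
    (hcov : ∀ x : ℝ, (L : ℝ) ≤ |x| → |noiseCov (2 * H) x| ≤ 1 / (2 * m)) (hn : 0 < n)
    {l : ℝ} (hl : 0 < l) :
    ∫ ω, Real.exp (-l * sumSqIncrements ω n) ∂μ ≤ (√(l * L * (n : ℝ) ^ (-(2 * H))))⁻¹ ^ m := by
  have : IsProbabilityMeasure μ := h.1
  have hL' : (0 : ℝ) < L := by exact_mod_cast hL
  have hn' : (0 : ℝ) < n := by exact_mod_cast hn
  set D : ℕ → PathSpace → ℝ := fun i ω => ω.1 (gridPt n (i + 1)) - ω.1 (gridPt n i)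
  have hD : ∀ i, Measurable (D i) := fun i => (measurable_eval _).sub (measurable_eval _)
  have hblock : ∀ r ∈ Finset.range L,
      ∫ ω, Real.exp (-(l * L) * ∑ j : Fin m, D (r + j * L) ω ^ 2) ∂μ ≤
        (√(l * L * (n : ℝ) ^ (-(2 * H))))⁻¹ ^ m := by
    intro r hr
    have hk : ∀ j : Fin m, r + j * L < n := by
      intro j
      have h1 := Finset.mem_range.1 hr
      have h2 : (j + 1) * L ≤ m * L := Nat.mul_le_mul_right L j.2
      nlinarith
    have hs : 0 < (n : ℝ) ^ (-(2 * H)) / 2 := by positivity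
    have hbound := integral_exp_neg_mul_sum_sq_le (fun j : Fin m => hD (r + j * L))
      (fun g => h.map_sum_gridIncrements hk g) hs (fun g => ?_) (mul_pos hl hL')
    · rwa [show 2 * (l * L * ((n : ℝ) ^ (-(2 * H)) / 2)) = l * L * (n : ℝ) ^ (-(2 * H)) by
        ring] at hbound
    · have hmat := half_sum_sq_le_of_offDiag_small
        (A := fun i j : Fin m => noiseCov (2 * H) (((r + i * L : ℕ) : ℝ) - (r + j * L : ℕ)))
        (fun i => by rw [sub_self, noiseCov_zero (by linarith [hH.1] : (2 * H) ≠ 0)])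
        (fun i j hij => hcov _ ?_) g
      · refine le_trans ?_ (Real.le_coe_toNNReal _)
        have := mul_le_mul_of_nonneg_left hmat (by positivity : 0 ≤ (n : ℝ) ^ (-(2 * H)))
        linarith
      · push_cast
        rw [show (r : ℝ) + i * L - (r + j * L) = ((i : ℝ) - j) * L by ring, abs_mul,
          abs_of_pos hL']
        refine le_mul_of_one_le_left hL'.le ?_
        have hne : ((i : ℕ) : ℤ) - (j : ℕ) ≠ 0 := by
          have := Fin.val_ne_of_ne hij
          omega
        exact_mod_cast Int.one_le_abs hne
  calc ∫ ω, Real.exp (-l * sumSqIncrements ω n) ∂μ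
      ≤ ∫ ω, ∑ r ∈ Finset.range L,
          (L : ℝ)⁻¹ * Real.exp (-(l * L) * ∑ j : Fin m, D (r + j * L) ω ^ 2) ∂μ := by
        refine integral_mono
          (integrable_exp_neg_mul (measurable_sumSqIncrements n)
            (fun ω => sumSqIncrements_nonneg ω n) hl.le)
          (integrable_finsetSum _ fun r _ => (integrable_exp_neg_mul (by fun_prop)
            (fun ω => by positivity) (by positivity)).const_mul _) fun ω => ?_
        have hsub : ∑ r ∈ Finset.range L, ∑ j : Fin m, D (r + j * L) ω ^ 2 ≤
            sumSqIncrements ω n := by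
          rw [← sum_range_mul_eq_sum_sum (fun i => D i ω ^ 2)]
          exact Finset.sum_le_sum_of_subset_of_nonneg (Finset.range_mono hLm)
            fun _ _ _ => sq_nonneg _
        calc Real.exp (-l * sumSqIncrements ω n)
            ≤ Real.exp (∑ r ∈ Finset.range L, -l * ∑ j : Fin m, D (r + j * L) ω ^ 2) := by
              rw [Real.exp_le_exp, ← Finset.mul_sum]
              have := mul_le_mul_of_nonneg_left hsub hl.le
              linarith
          _ ≤ _ := exp_sum_le_average hL _
          _ = _ := Finset.sum_congr rfl fun r _ => by
              congr 2
              ring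
    _ = ∑ r ∈ Finset.range L, (L : ℝ)⁻¹ *
          ∫ ω, Real.exp (-(l * L) * ∑ j : Fin m, D (r + j * L) ω ^ 2) ∂μ := by
        rw [integral_finsetSum _ fun r _ => (integrable_exp_neg_mul (by fun_prop)
            (fun ω => by positivity) (by positivity)).const_mul _]
        exact Finset.sum_congr rfl fun r _ => integral_const_mul _ _
    _ ≤ ∑ r ∈ Finset.range L, (L : ℝ)⁻¹ * (√(l * L * (n : ℝ) ^ (-(2 * H))))⁻¹ ^ m :=
        Finset.sum_le_sum fun r hr => mul_le_mul_of_nonneg_left (hblock r hr) (by positivity)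
    _ = _ := by
        rw [Finset.sum_const, Finset.card_range, nsmul_eq_mul, mul_inv_cancel_left₀ hL'.ne']

/-- Borel–Cantelli with an eventual summable bound. -/
lemma ae_eventually_notMem_of_measureReal_le {Ω' : Type*} [MeasurableSpace Ω'] {μ : Measure Ω'}
    [IsFiniteMeasure μ] {s : ℕ → Set Ω'} {u : ℕ → ℝ} (hu : Summable u)
    (hs : ∀ᶠ n in atTop, μ.real (s n) ≤ u n) : ∀ᵐ ω ∂μ, ∀ᶠ n in atTop, ω ∉ s n := by
  have hsum : Summable fun n => μ.real (s n) :=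
    Summable.of_norm_bounded_eventually_nat hu (by
      filter_upwards [hs] with n hn
      rwa [Real.norm_of_nonneg measureReal_nonneg])
  refine ae_eventually_notMem ?_
  have := hsum.tsum_ofReal_ne_top
  simpa [ofReal_measureReal] using this

lemma IsFBM.measureReal_sumSqIncrements_le {H : ℝ} (hH : H ∈ Ioo (0 : ℝ) 1)
    {μ : Measure PathSpace} (h : IsFBM H μ) {ε : ℝ} {m n : ℕ} (hm : 0 < m) (hn : m ≤ n)
    (hεm : 4 ≤ ε * m)
    (hcov : ∀ x : ℝ, ((n / m : ℕ) : ℝ) ≤ |x| → |noiseCov (2 * H) x| ≤ 1 / (2 * m)) :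
    μ.real {ω | sumSqIncrements ω n ≤ (n : ℝ) ^ (1 - 2 * H - ε)} ≤
      Real.exp 1 * √(2 * m) ^ m * ((n : ℝ) ^ (2 : ℕ))⁻¹ := by
  have : IsProbabilityMeasure μ := h.1
  have hn0 : 0 < n := hm.trans_le hn
  have hn' : (1 : ℝ) ≤ n := by exact_mod_cast hn0
  have hnpos : (0 : ℝ) < n := by linarith
  have hm' : (0 : ℝ) < m := by exact_mod_cast hm
  set L := n / m
  have hL : 0 < L := Nat.div_pos hn hm
  have hLlow : (n : ℝ) / (2 * m) ≤ L := by
    rw [div_le_iff₀ (by positivity)]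
    have h1 : n < m * (L + 1) := Nat.lt_mul_div_succ n hm
    have h2 : m * (L + 1) ≤ L * (2 * m) := by nlinarith
    exact_mod_cast (h1.trans_le h2).le
  set l : ℝ := (n : ℝ) ^ (2 * H + ε - 1)
  have hl : 0 < l := by positivity
  have hlap := h.integral_exp_neg_sumSqIncrements_le hH hL (Nat.div_mul_le_self n m) hcov hn0 hl
  have hbase : (n : ℝ) ^ ε / (2 * m) ≤ l * L * (n : ℝ) ^ (-(2 * H)) := by
    calc (n : ℝ) ^ ε / (2 * m) = l * (n / (2 * m)) * (n : ℝ) ^ (-(2 * H)) := by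
          rw [show ε = (2 * H + ε - 1) + 1 + (-(2 * H)) by ring, Real.rpow_add hnpos,
            Real.rpow_add hnpos, Real.rpow_one]
          simp only [l]
          ring_nf
      _ ≤ _ := by gcongr
  have hpow : (√(l * L * (n : ℝ) ^ (-(2 * H))))⁻¹ ^ m ≤
      √(2 * m) ^ m * ((n : ℝ) ^ (2 : ℕ))⁻¹ := by
    calc (√(l * L * (n : ℝ) ^ (-(2 * H))))⁻¹ ^ m ≤ (√((n : ℝ) ^ ε / (2 * m)))⁻¹ ^ m := by
          gcongr
      _ = √(2 * m) ^ m * (√((n : ℝ) ^ ε) ^ m)⁻¹ := by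
          rw [Real.sqrt_div (by positivity), inv_div, div_pow, div_eq_mul_inv]
      _ ≤ _ := by
          gcongr
          rw [Real.sqrt_eq_rpow, ← Real.rpow_mul hnpos.le, ← Real.rpow_natCast, ←
            Real.rpow_natCast, ← Real.rpow_mul hnpos.le]
          refine Real.rpow_le_rpow_of_exponent_le hn' ?_
          push_cast
          linarith
  have hmarkov := mul_meas_ge_le_integral_of_nonneg
    (ae_of_all μ fun ω => (Real.exp_pos (-l * sumSqIncrements ω n)).le)
    (integrable_exp_neg_mul (measurable_sumSqIncrements n)
      (fun ω => sumSqIncrements_nonneg ω n) hl.le) (Real.exp (-1))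
  have hsub : {ω | sumSqIncrements ω n ≤ (n : ℝ) ^ (1 - 2 * H - ε)} ⊆
      {ω | Real.exp (-1) ≤ Real.exp (-l * sumSqIncrements ω n)} := by
    intro ω hω
    refine Real.exp_le_exp.2 ?_
    have h1 : l * sumSqIncrements ω n ≤ l * (n : ℝ) ^ (1 - 2 * H - ε) :=
      mul_le_mul_of_nonneg_left hω hl.le
    have h2 : l * (n : ℝ) ^ (1 - 2 * H - ε) = 1 := by
      rw [← Real.rpow_add hnpos, show 2 * H + ε - 1 + (1 - 2 * H - ε) = 0 by ring,
        Real.rpow_zero]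
    linarith
  calc μ.real {ω | sumSqIncrements ω n ≤ (n : ℝ) ^ (1 - 2 * H - ε)}
      ≤ μ.real {ω | Real.exp (-1) ≤ Real.exp (-l * sumSqIncrements ω n)} := measureReal_mono hsub
    _ = Real.exp 1 * (Real.exp (-1) *
          μ.real {ω | Real.exp (-1) ≤ Real.exp (-l * sumSqIncrements ω n)}) := by
        rw [← mul_assoc, ← Real.exp_add]; simp
    _ ≤ Real.exp 1 * (√(2 * m) ^ m * ((n : ℝ) ^ (2 : ℕ))⁻¹) := by
        exact mul_le_mul_of_nonneg_left (hmarkov.trans (hlap.trans hpow)) (Real.exp_pos _).le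
    _ = _ := by ring

/-- Almost surely, the quadratic variation of fractional Brownian motion is eventually at least
`n ^ (1 - 2H - ε)`. -/
lemma IsFBM.ae_eventually_lt_sumSqIncrements {H : ℝ} (hH : H ∈ Ioo (0 : ℝ) 1)
    {μ : Measure PathSpace} (h : IsFBM H μ) {ε : ℝ} (hε : 0 < ε) :
    ∀ᵐ ω ∂μ, ∀ᶠ n : ℕ in atTop, (n : ℝ) ^ (1 - 2 * H - ε) < sumSqIncrements ω n := by
  have : IsProbabilityMeasure μ := h.1
  obtain ⟨m, hm⟩ := exists_nat_gt (4 / ε)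
  have hm' : (0 : ℝ) < m := lt_trans (by positivity) hm
  have hm0 : 0 < m := by exact_mod_cast hm'
  obtain ⟨K, hK⟩ := exists_forall_abs_noiseCov_le (a := 2 * H) (δ := 1 / (2 * m))
    (by linarith [hH.1]) (by linarith [hH.2]) (by positivity)
  have hu : Summable fun n : ℕ =>
      Real.exp 1 * √(2 * m) ^ m * ((n : ℝ) ^ (2 : ℕ))⁻¹ :=
    (Real.summable_nat_pow_inv.2 (by norm_num)).mul_left _
  have hdiv : Tendsto (fun n : ℕ => ((n / m : ℕ) : ℝ)) atTop atTop :=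
    tendsto_natCast_atTop_atTop.comp (Nat.tendsto_div_const_atTop hm0.ne')
  have hae := ae_eventually_notMem_of_measureReal_le (μ := μ)
    (s := fun n : ℕ => {ω | sumSqIncrements ω n ≤ (n : ℝ) ^ (1 - 2 * H - ε)}) hu (by
      filter_upwards [eventually_ge_atTop m, hdiv.eventually_ge_atTop K] with n hn hnK
      refine h.measureReal_sumSqIncrements_le hH hm0 hn ?_ fun x hx => hK x (hnK.trans hx)
      rw [div_lt_iff₀ hε] at hm
      linarith)
  filter_upwards [hae] with ω hω
  filter_upwards [hω] with n hn
  simpa using hn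

/-- Markov's inequality of order `2p` for a centered Gaussian variable of variance `v`. -/
lemma measureReal_le_abs_of_map_eq_gaussianReal {Ω' : Type*} [MeasurableSpace Ω'] {μ : Measure Ω'}
    [IsProbabilityMeasure μ] {Z : Ω' → ℝ} (hZ : Measurable Z) {v : ℝ} (hv : 0 ≤ v)
    (hlaw : μ.map Z = gaussianReal 0 v.toNNReal) (p : ℕ) {a : ℝ} (ha : 0 < a) :
    μ.real {ω | a ≤ |Z ω|} ≤ (∫ x, x ^ (2 * p) ∂(gaussianReal 0 1)) * v ^ p / a ^ (2 * p) := by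
  have hscale : (gaussianReal 0 1).map (√v * ·) = gaussianReal 0 v.toNNReal := by
    rw [gaussianReal_map_const_mul, mul_zero, mul_one]
    congr 1
    ext
    simp [Real.sq_sqrt hv, hv]
  have hmom : ∫ ω, Z ω ^ (2 * p) ∂μ = (∫ x, x ^ (2 * p) ∂(gaussianReal 0 1)) * v ^ p := by
    rw [← integral_map (f := fun x : ℝ => x ^ (2 * p)) hZ.aemeasurable (by fun_prop), hlaw,
      ← hscale, integral_map (by fun_prop) (by fun_prop)]
    simp_rw [mul_pow, pow_mul (√v), Real.sq_sqrt hv]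
    rw [integral_const_mul, mul_comm]
  have hintegrable : Integrable (fun ω => Z ω ^ (2 * p)) μ := by
    have hid : Integrable (fun x : ℝ => x ^ (2 * p)) (μ.map Z) := by
      rw [hlaw]
      have h := (memLp_id_gaussianReal' (μ := 0) (v := v.toNNReal) ((2 * p : ℕ) : ℝ≥0∞)
        (ENNReal.natCast_ne_top _)).integrable_norm_pow'
      refine h.congr (ae_of_all _ fun x => ?_)
      simp [pow_mul]
    exact hid.comp_measurable hZ
  have hmarkov := mul_meas_ge_le_integral_of_nonneg
    (ae_of_all μ fun ω => (even_two_mul p).pow_nonneg (Z ω)) hintegrable (a ^ (2 * p))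
  rw [hmom] at hmarkov
  rw [le_div_iff₀ (by positivity), mul_comm]
  refine le_trans (mul_le_mul_of_nonneg_left (measureReal_mono fun ω hω => ?_) (by positivity))
    hmarkov
  show a ^ (2 * p) ≤ Z ω ^ (2 * p)
  rw [← (even_two_mul p).pow_abs (Z ω)]
  exact pow_le_pow_left₀ ha.le hω _

/-- The largest dyadic increment of level `n` is almost surely eventually below `2 ^ (-bn)`. -/
lemma IsFBM.ae_eventually_dyadic_increment_lt {H : ℝ} (hH : 0 < H) {μ : Measure PathSpace}
    (h : IsFBM H μ) {b : ℝ} (hb : b < H) :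
    ∀ᵐ ω : PathSpace ∂μ, ∀ᶠ n : ℕ in atTop, ∀ i < 2 ^ n,
      |ω.1 (gridPt (2 ^ n) (i + 1)) - ω.1 (gridPt (2 ^ n) i)| < ((2 : ℝ) ^ n) ^ (-b) := by
  have : IsProbabilityMeasure μ := h.1
  obtain ⟨p, hp⟩ := exists_nat_gt (1 / (H - b))
  rw [div_lt_iff₀ (by linarith)] at hp
  set M : ℝ := ∫ x, x ^ (2 * p) ∂(gaussianReal 0 1)
  have hM : 0 ≤ M := integral_nonneg fun x => (even_two_mul p).pow_nonneg x
  have hu : Summable fun n : ℕ => M * (1 / 2 : ℝ) ^ n :=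
    (summable_geometric_of_lt_one (by norm_num) (by norm_num)).mul_left _
  have hae := ae_eventually_notMem_of_measureReal_le (μ := μ)
    (s := fun n : ℕ => ⋃ i ∈ Finset.range (2 ^ n), {ω : PathSpace | ((2 : ℝ) ^ n) ^ (-b) ≤
      |ω.1 (gridPt (2 ^ n) (i + 1)) - ω.1 (gridPt (2 ^ n) i)|}) hu
    (Eventually.of_forall fun n => ?_)
  · filter_upwards [hae] with ω hω
    filter_upwards [hω] with n hn i hi
    by_contra hcon
    exact hn (mem_iUnion₂.2 ⟨i, Finset.mem_range.2 hi, not_lt.1 hcon⟩)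
  · set N : ℝ := (2 : ℝ) ^ n with hN
    have hN1 : 1 ≤ N := one_le_pow₀ (by norm_num)
    have hN0 : 0 < N := by linarith
    have hsingle : ∀ i ∈ Finset.range (2 ^ n), μ.real {ω : PathSpace | N ^ (-b) ≤
        |ω.1 (gridPt (2 ^ n) (i + 1)) - ω.1 (gridPt (2 ^ n) i)|} ≤ M * N ^ (-2 : ℝ) := by
      intro i hi
      have hi' := Finset.mem_range.1 hi
      have hlaw := h.map_increment hH (gridPt (2 ^ n) i) (gridPt (2 ^ n) (i + 1))
      rw [coe_gridPt hi', coe_gridPt hi'.le, ← sub_div] at hlaw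
      push_cast at hlaw
      rw [add_sub_cancel_left, ← hN, abs_of_pos (by positivity)] at hlaw
      refine (measureReal_le_abs_of_map_eq_gaussianReal
        ((measurable_eval _).sub (measurable_eval _)) (by positivity) hlaw p
        (by positivity : 0 < N ^ (-b))).trans ?_
      rw [mul_div_assoc]
      refine mul_le_mul_of_nonneg_left ?_ hM
      rw [one_div, Real.inv_rpow hN0.le, ← Real.rpow_neg hN0.le, ← Real.rpow_mul_natCast hN0.le,
        ← Real.rpow_mul_natCast hN0.le, ← Real.rpow_sub hN0]
      refine Real.rpow_le_rpow_of_exponent_le hN1 ?_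
      push_cast
      nlinarith
    refine (measureReal_biUnion_finset_le _ _).trans ((Finset.sum_le_sum hsingle).trans ?_)
    rw [Finset.sum_const, Finset.card_range, nsmul_eq_mul]
    push_cast
    rw [← hN, one_div, inv_pow, ← hN, Real.rpow_neg hN0.le]
    refine le_of_eq ?_
    rw [show (2 : ℝ) = ((2 : ℕ) : ℝ) by norm_num, Real.rpow_natCast]
    field_simp

lemma gridPt_two_pow_succ (n k : ℕ) : gridPt (2 ^ (n + 1)) (2 * k) = gridPt (2 ^ n) k := by
  unfold gridPt
  congr 1
  push_cast
  rw [pow_succ, mul_comm, mul_div_mul_right _ _ two_ne_zero]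

lemma floor_le_of_unitInterval (N : ℕ) (x : unitInterval) : ⌊(N : ℝ) * x⌋₊ ≤ N :=
  Nat.floor_le_of_le (mul_le_of_le_one_right (by positivity) x.2.2)

/-- Dyadic chaining: geometric control of a path along its dyadic approximations. -/
lemma dist_dyadic_floor_le {ω : PathSpace} {C r : ℝ} (hC : 0 ≤ C) (hr0 : 0 ≤ r) (hr1 : r < 1)
    (hω : ∀ n : ℕ, ∀ i < 2 ^ n,
      |ω.1 (gridPt (2 ^ n) (i + 1)) - ω.1 (gridPt (2 ^ n) i)| ≤ C * r ^ n)
    (x : unitInterval) (n : ℕ) :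
    dist (ω.1 (gridPt (2 ^ n) ⌊((2 ^ n : ℕ) : ℝ) * x⌋₊)) (ω.1 x) ≤ C * r ^ n / (1 - r) := by
  refine dist_le_of_le_geometric_of_tendsto
    (f := fun n : ℕ => ω.1 (gridPt (2 ^ n) ⌊((2 ^ n : ℕ) : ℝ) * x⌋₊)) r C hr1 (fun n => ?_) ?_ n
  · set k := ⌊((2 ^ n : ℕ) : ℝ) * x⌋₊
    set k' := ⌊((2 ^ (n + 1) : ℕ) : ℝ) * x⌋₊ with hk'
    have hx0 : (0 : ℝ) ≤ x := x.2.1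
    have hk'le : k' ≤ 2 ^ (n + 1) := floor_le_of_unitInterval _ x
    have hpow : ((2 ^ (n + 1) : ℕ) : ℝ) * x = 2 * (((2 ^ n : ℕ) : ℝ) * x) := by
      push_cast; ring
    have hk1 : (k : ℝ) ≤ ((2 ^ n : ℕ) : ℝ) * x := Nat.floor_le (by positivity)
    have hk2 : ((2 ^ n : ℕ) : ℝ) * x < k + 1 := Nat.lt_floor_add_one _
    have hlow : 2 * k ≤ k' := by
      rw [hk']
      apply Nat.le_floor
      rw [hpow]
      push_cast at hk1 ⊢
      linarith
    have hup : k' < 2 * k + 2 := by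
      rw [hk', Nat.floor_lt (by positivity), hpow]
      push_cast at hk2 ⊢
      linarith
    rw [← gridPt_two_pow_succ n k]
    rcases (by omega : k' = 2 * k ∨ k' = 2 * k + 1) with hcase | hcase
    · rw [hcase, dist_self]
      positivity
    · rw [hcase, dist_comm, Real.dist_eq]
      refine (hω (n + 1) (2 * k) (by omega)).trans ?_
      refine mul_le_mul_of_nonneg_left ?_ hC
      exact pow_le_pow_of_le_one hr0 hr1.le n.le_succ
  · refine (ω.1.continuous.tendsto x).comp (tendsto_subtype_rng.2 ?_)
    have hfl : ∀ n : ℕ, (gridPt (2 ^ n) ⌊((2 ^ n : ℕ) : ℝ) * x⌋₊ : ℝ) =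
        (⌊(x : ℝ) * ((2 ^ n : ℕ) : ℝ)⌋₊ : ℝ) / ((2 ^ n : ℕ) : ℝ) := by
      intro n
      rw [coe_gridPt (floor_le_of_unitInterval _ x), mul_comm]
    simp_rw [hfl]
    exact (tendsto_nat_floor_mul_div_atTop x.2.1).comp
      (tendsto_natCast_atTop_atTop.comp (tendsto_pow_atTop_atTop_of_one_lt one_lt_two))

/-- A path whose dyadic increments decay like `2 ^ (-bn)` is `b`-Hölder. -/
lemma mem_holderSet_of_dyadic {ω : PathSpace} {C b : ℝ} (hC : 0 ≤ C) (hb : 0 < b)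
    (hω : ∀ n : ℕ, ∀ i < 2 ^ n,
      |ω.1 (gridPt (2 ^ n) (i + 1)) - ω.1 (gridPt (2 ^ n) i)| ≤ C * ((2 : ℝ) ^ n) ^ (-b)) :
    ω ∈ holderSet b := by
  set r : ℝ := (1 / 2 : ℝ) ^ b with hr
  have hr0 : 0 < r := by positivity
  have hr1 : r < 1 := Real.rpow_lt_one (by norm_num) (by norm_num) hb
  have hrn : ∀ n : ℕ, ((1 / 2 : ℝ) ^ n) ^ b = r ^ n := fun n => by
    rw [hr, ← Real.rpow_natCast, ← Real.rpow_natCast, ← Real.rpow_mul (by norm_num),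
      ← Real.rpow_mul (by norm_num), mul_comm]
  have hω' : ∀ n : ℕ, ∀ i < 2 ^ n,
      |ω.1 (gridPt (2 ^ n) (i + 1)) - ω.1 (gridPt (2 ^ n) i)| ≤ C * r ^ n := by
    intro n i hi
    rw [← hrn, one_div, inv_pow, Real.inv_rpow (by positivity), ← Real.rpow_neg (by positivity)]
    exact hω n i hi
  have h1r : 0 < 1 - r := by linarith
  refine ⟨(C + 2 * (C / (1 - r))) / r, ?_⟩
  have key : ∀ x y : unitInterval, (x : ℝ) < y →
      |ω.1 x - ω.1 y| ≤ (C + 2 * (C / (1 - r))) / r * |(x : ℝ) - y| ^ b := by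
    intro x y hxy
    have hx0 : (0 : ℝ) ≤ x := x.2.1
    have hy1 : (y : ℝ) ≤ 1 := y.2.2
    obtain ⟨n, hn1, hn2⟩ := exists_nat_pow_near_of_lt_one (x := (y : ℝ) - x) (y := 1 / 2)
      (by linarith) (by linarith) (by norm_num) (by norm_num)
    set k := ⌊((2 ^ n : ℕ) : ℝ) * x⌋₊ with hk
    set k' := ⌊((2 ^ n : ℕ) : ℝ) * y⌋₊ with hk'
    have hkk' : k ≤ k' := Nat.floor_le_floor (by gcongr)
    have hk'k : k' ≤ k + 1 := by
      rw [hk, hk', ← Nat.floor_add_one (by positivity)]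
      refine Nat.floor_le_floor ?_
      have h2 : ((2 ^ n : ℕ) : ℝ) * (y - x) ≤ ((2 ^ n : ℕ) : ℝ) * (1 / 2) ^ n := by gcongr
      have h3 : ((2 ^ n : ℕ) : ℝ) * (1 / 2) ^ n = 1 := by
        push_cast
        rw [← mul_pow]
        norm_num
      linarith
    have hmid : dist (ω.1 (gridPt (2 ^ n) k)) (ω.1 (gridPt (2 ^ n) k')) ≤ C * r ^ n := by
      rcases (by omega : k' = k ∨ k' = k + 1) with hcase | hcase
      · rw [hcase, dist_self]
        positivity
      · have hle : k' ≤ 2 ^ n := floor_le_of_unitInterval _ y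
        rw [hcase, dist_comm, Real.dist_eq]
        exact hω' n k (by omega)
    have hxn := dist_dyadic_floor_le hC hr0.le hr1 hω' x n
    have hyn := dist_dyadic_floor_le hC hr0.le hr1 hω' y n
    have htri := dist_triangle4 (ω.1 x) (ω.1 (gridPt (2 ^ n) k)) (ω.1 (gridPt (2 ^ n) k')) (ω.1 y)
    rw [dist_comm (ω.1 x) (ω.1 (gridPt (2 ^ n) k))] at htri
    have hrb : r ^ n * r ≤ |(x : ℝ) - y| ^ b := by
      rw [← pow_succ, ← hrn, abs_sub_comm, abs_of_pos (by linarith)]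
      exact Real.rpow_le_rpow (by positivity) hn1.le hb.le
    rw [← Real.dist_eq]
    calc dist (ω.1 x) (ω.1 y)
        ≤ C * r ^ n / (1 - r) + C * r ^ n + C * r ^ n / (1 - r) := by linarith
      _ = (C + 2 * (C / (1 - r))) / r * (r ^ n * r) := by
          field_simp
          ring
      _ ≤ _ := mul_le_mul_of_nonneg_left hrb (by positivity)
  intro x y
  rcases lt_trichotomy (x : ℝ) y with hxy | hxy | hxy
  · exact key x y hxy
  · rw [Subtype.ext hxy]
    simp [Real.zero_rpow hb.ne']
  · rw [abs_sub_comm, abs_sub_comm (x : ℝ)]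
    exact key y x hxy

lemma IsFBM.ae_mem_holderSet {H : ℝ} (hH : 0 < H) {μ : Measure PathSpace} (h : IsFBM H μ) {b : ℝ}
    (hb0 : 0 < b) (hb : b < H) : ∀ᵐ ω ∂μ, ω ∈ holderSet b := by
  filter_upwards [h.ae_eventually_dyadic_increment_lt hH hb] with ω hω
  obtain ⟨n₀, hn₀⟩ := eventually_atTop.1 hω
  set B : ℝ := 2 * ‖ω.1‖ * ((2 : ℝ) ^ n₀) ^ b
  refine mem_holderSet_of_dyadic (C := max 1 B) (by positivity) hb0 fun n i hi => ?_
  rcases le_or_gt n₀ n with hn | hn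
  · refine (hn₀ n hn i hi).le.trans (le_mul_of_one_le_left (by positivity) (le_max_left _ _))
  · have h1 : |ω.1 (gridPt (2 ^ n) (i + 1)) - ω.1 (gridPt (2 ^ n) i)| ≤ 2 * ‖ω.1‖ := by
      have h2 := ω.1.norm_coe_le_norm (gridPt (2 ^ n) (i + 1))
      have h3 := ω.1.norm_coe_le_norm (gridPt (2 ^ n) i)
      refine (abs_sub _ _).trans ?_
      rw [Real.norm_eq_abs] at h2 h3
      linarith
    have h4 : 1 ≤ ((2 : ℝ) ^ n₀) ^ b * ((2 : ℝ) ^ n) ^ (-b) := by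
      rw [Real.rpow_neg (by positivity), ← div_eq_mul_inv, one_le_div (by positivity)]
      gcongr
      norm_num
    calc _ ≤ 2 * ‖ω.1‖ := h1
      _ ≤ 2 * ‖ω.1‖ * (((2 : ℝ) ^ n₀) ^ b * ((2 : ℝ) ^ n) ^ (-b)) :=
          le_mul_of_one_le_right (by positivity) h4
      _ = B * ((2 : ℝ) ^ n) ^ (-b) := by ring
      _ ≤ _ := mul_le_mul_of_nonneg_right (le_max_right _ _) (by positivity)

lemma holderSet_anti {a b : ℝ} (hb : 0 < b) (hab : b ≤ a) : holderSet a ⊆ holderSet b := by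
  rintro ω ⟨C, hC⟩
  refine ⟨max C 0, fun x y => (hC x y).trans ?_⟩
  have h1 : |(x : ℝ) - y| ≤ 1 := by
    rw [abs_le]
    constructor <;> linarith [x.2.1, x.2.2, y.2.1, y.2.2]
  exact mul_le_mul (le_max_left _ _)
    (Real.rpow_le_rpow_of_exponent_ge_of_imp (abs_nonneg _) h1 hab
      fun _ h => absurd h (hb.trans_le hab).ne')
    (by positivity) (le_max_right _ _)

lemma sumSqIncrements_le_of_mem_holderSet {ω : PathSpace} {b : ℝ} (hω : ω ∈ holderSet b) :
    ∃ C : ℝ, 0 < C ∧ ∀ n : ℕ, 0 < n → sumSqIncrements ω n ≤ n * (C * (n : ℝ) ^ (-b)) ^ 2 := by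
  obtain ⟨C, hC⟩ := hω
  refine ⟨max C 1, by positivity, fun n hn => ?_⟩
  have hn' : (0 : ℝ) < n := by exact_mod_cast hn
  have hterm : ∀ i ∈ Finset.range n, (ω.1 (gridPt n (i + 1)) - ω.1 (gridPt n i)) ^ 2 ≤
      (max C 1 * (n : ℝ) ^ (-b)) ^ 2 := by
    intro i hi
    have hi' := Finset.mem_range.1 hi
    have h1 := hC (gridPt n (i + 1)) (gridPt n i)
    rw [coe_gridPt hi', coe_gridPt hi'.le, ← sub_div, Nat.cast_succ, add_sub_cancel_left,
      abs_of_pos (one_div_pos.2 hn'), one_div, Real.inv_rpow hn'.le, ← Real.rpow_neg hn'.le] at h1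
    rw [← sq_abs]
    gcongr
    exact h1.trans (mul_le_mul_of_nonneg_right (le_max_left _ _) (by positivity))
  refine (Finset.sum_le_sum hterm).trans_eq ?_
  rw [Finset.sum_const, Finset.card_range, nsmul_eq_mul]

lemma Qvar_sq (ω : PathSpace) (n : ℕ) : Qvar ω n ^ 2 = sumSqIncrements ω n / n := by
  rw [Qvar, Real.sq_sqrt (by positivity), sumSqIncrements]
  ring

lemma lt_oreyRatio_of_mem_holderSet {ω : PathSpace} {a b : ℝ} (hab : a < b)
    (hω : ω ∈ holderSet b) (hpos : ∀ᶠ n : ℕ in atTop, 0 < sumSqIncrements ω n) :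
    ∀ᶠ n : ℕ in atTop, a < -Real.log (Qvar ω n) / Real.log n := by
  obtain ⟨C, hC0, hC⟩ := sumSqIncrements_le_of_mem_holderSet hω
  have hlog : Tendsto (fun n : ℕ => Real.log n) atTop atTop :=
    Real.tendsto_log_atTop.comp tendsto_natCast_atTop_atTop
  filter_upwards [hpos, eventually_gt_atTop 0, hlog.eventually_gt_atTop 0,
    hlog.eventually_gt_atTop (Real.log C / (b - a))] with n hn hn0 hln hbig
  have hn' : (0 : ℝ) < n := by exact_mod_cast hn0
  have hQ0 : 0 < Qvar ω n :=
    lt_of_pow_lt_pow_left₀ 2 (Real.sqrt_nonneg _) (by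
      rw [Qvar_sq, zero_pow two_ne_zero]; exact div_pos hn hn')
  have hQ : Qvar ω n ≤ C * (n : ℝ) ^ (-b) := by
    refine le_of_sq_le_sq ?_ (by positivity)
    rw [Qvar_sq, div_le_iff₀ hn', mul_comm]
    exact hC n hn0
  have hlogQ := Real.log_le_log hQ0 hQ
  rw [Real.log_mul hC0.ne' (by positivity), Real.log_rpow hn'] at hlogQ
  rw [div_lt_iff₀ (by linarith)] at hbig
  rw [lt_div_iff₀ hln]
  linarith

lemma oreyRatio_lt_of_sumSqIncrements {ω : PathSpace} {H ε : ℝ}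
    (hω : ∀ᶠ n : ℕ in atTop, (n : ℝ) ^ (1 - 2 * H - 2 * ε) < sumSqIncrements ω n) :
    ∀ᶠ n : ℕ in atTop, -Real.log (Qvar ω n) / Real.log n < H + ε := by
  filter_upwards [hω, eventually_gt_atTop 1] with n hn hn1
  have hn' : (1 : ℝ) < n := by exact_mod_cast hn1
  have hn0 : (0 : ℝ) < n := by linarith
  have hQ : (n : ℝ) ^ (-(H + ε)) < Qvar ω n := by
    refine lt_of_pow_lt_pow_left₀ 2 (Real.sqrt_nonneg _) ?_
    rw [Qvar_sq, lt_div_iff₀ hn0, ← Real.rpow_mul_natCast hn0.le, ← Real.rpow_add_one hn0.ne',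
      show -(H + ε) * ((2 : ℕ) : ℝ) + 1 = 1 - 2 * H - 2 * ε by push_cast; ring]
    exact hn
  have hlogQ := Real.log_lt_log (by positivity) hQ
  rw [Real.log_rpow hn0] at hlogQ
  rw [div_lt_iff₀ (Real.log_pos hn')]
  linarith

/-- **Orey exponent of fBm.** For `W^H`-almost every path `ω`, the Orey exponent
of `ω` exists and equals `H`, and `ω` is nearly `H`-Hölder. -/
theorem fbm_orey (H : ℝ) (hH : H ∈ Set.Ioo (0:ℝ) 1)
    (WH : Measure PathSpace) (hWH : IsFBM H WH) :
    ∀ᵐ ω ∂WH, oreyLower ω = (H : EReal) ∧ oreyUpper ω = (H : EReal) ∧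
      ω ∈ holderMinus H := by
  have hholder : ∀ᵐ ω ∂WH, ∀ q : ℚ, 0 < (q : ℝ) → (q : ℝ) < H → ω ∈ holderSet q :=
    ae_all_iff.2 fun q => by
      by_cases h : 0 < (q : ℝ) ∧ (q : ℝ) < H
      · filter_upwards [hWH.ae_mem_holderSet hH.1 h.1 h.2] with ω hω _ _ using hω
      · exact ae_of_all _ fun ω h0 h1 => absurd ⟨h0, h1⟩ h
  have hlower : ∀ᵐ ω ∂WH, ∀ k : ℕ, ∀ᶠ n : ℕ in atTop,
      (n : ℝ) ^ (1 - 2 * H - 2 * (1 / ((k : ℝ) + 1))) < sumSqIncrements ω n :=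
    ae_all_iff.2 fun k => hWH.ae_eventually_lt_sumSqIncrements hH (by positivity)
  filter_upwards [hholder, hlower] with ω hω hω'
  have hpos : ∀ᶠ n : ℕ in atTop, 0 < sumSqIncrements ω n := by
    filter_upwards [hω' 0] with n hn using (Real.rpow_nonneg n.cast_nonneg _).trans_lt hn
  have hlim : Tendsto (fun n : ℕ => -Real.log (Qvar ω n) / Real.log n) atTop (𝓝 H) := by
    refine tendsto_order.2 ⟨fun a ha => ?_, fun a ha => ?_⟩
    · obtain ⟨q, hq, hqH⟩ := exists_rat_btwn (max_lt ha hH.1)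
      exact lt_oreyRatio_of_mem_holderSet ((le_max_left _ _).trans_lt hq)
        (hω q ((le_max_right _ _).trans_lt hq) hqH) hpos
    · obtain ⟨k, hk⟩ := exists_nat_one_div_lt (sub_pos.2 ha)
      filter_upwards [oreyRatio_lt_of_sumSqIncrements (hω' k)] with n hn
      linarith
  have hlimE := (continuous_coe_real_ereal.tendsto H).comp hlim
  refine ⟨hlimE.liminf_eq, hlimE.limsup_eq, mem_iInter₂.2 fun b hb => ?_⟩
  obtain ⟨q, hbq, hqH⟩ := exists_rat_btwn hb.2
  exact holderSet_anti hb.1 hbq.le (hω q (hb.1.trans hbq) hqH)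

end Multifractal
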